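/- Shift identity for one-row weights: let λ = (λ_1 > ⋯ > λ_ℓ ≥ 0) and μ = (μ_1 > ⋯ > μ_{ℓ'} ≥ 0) be strict partitions, and set λ⁺ := (λ_1+m, …, λ_ℓ+m, m−1, m−2, …, 1, 0) and μ⁺ := (μ_1+m, …, μ_{ℓ'}+m, m−1, m−2, …, 1, 0). Then for every N > max(λ_1, μ_1) + m and every z ∈ ℂ*: Z_{μ⁺,λ⁺}(z) = (−Φ/q)^m · Z_{μ,λ}(z), where Z_{ν,κ}(z) denotes the sum of the weights of all one-row states on the N-column grid with top boundary κ and bottom boundary ν (there is at most one such state). -/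

import Mathlib

noncomputable section

/-- A spin: either `+` (`none`) or a color `c_i` represented by the residue class
`i mod m` of its index `i ∈ {1, …, m}` (`some` of that class). -/
abbrev Spin (m : ℕ) := Option (ZMod m)

/-- The representative in `{1, …, m}` of a residue class mod `m`. -/
def rep (m : ℕ) (x : ZMod m) : ℕ := (x - 1).val + 1

/-- Boltzmann weight of a T-vertex with column color (class) `j` and row parameter `z`,
on the spins `(a, b, c, d)` of its (left, top, right, bottom) edges; inadmissible
configurations get weight `0`. -/
def wt (m : ℕ) (q Φ : ℂ) (α : ZMod m → ZMod m → ℂ) (j : ZMod m) (z : ℂ) :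
    Spin m → Spin m → Spin m → Spin m → ℂ
  | some a, some b, some c, some d =>
      if b = j ∧ d = j ∧ c = a then (if a = j then Φ * q * z else Φ * α (-a) (-j)) else 0
  | none, some b, none, some d => if b = j ∧ d = j then -Φ / q else 0
  | some a, none, some c, none => if c = a then (if a = j then z else 1) else 0
  | some a, none, none, some d => if a = j ∧ d = j then -(Φ / q) * (1 - q ^ 2) * z else 0
  | none, some b, some c, none => if b = j ∧ c = j then 1 else 0
  | none, none, none, none => 1
  | _, _, _, _ => 0


/-- The admissible configurations `(a, b, c, d)` = (left, top, right, bottom) of a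
T-vertex with column color (class) `j`. -/
def Adm (m : ℕ) (j : ZMod m) (a b c d : Spin m) : Prop :=
  (a = none ∧ b = none ∧ c = none ∧ d = none) ∨
  (∃ i : ZMod m, a = some i ∧ b = some j ∧ c = some i ∧ d = some j) ∨
  (a = none ∧ b = some j ∧ c = none ∧ d = some j) ∨
  (∃ i : ZMod m, a = some i ∧ b = none ∧ c = some i ∧ d = none) ∨
  (a = some j ∧ b = none ∧ c = none ∧ d = some j) ∨
  (a = none ∧ b = some j ∧ c = some j ∧ d = none)

/-- The column color (class) of column number `k`: `j(k) ≡ −k (mod m)`. -/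
def colC (m k : ℕ) : ZMod m := -(k : ZMod m)

open Classical in
/-- The one-row partition function `Z_{ν,κ}(z)` on the `N`-column grid (columns numbered
`0, …, N − 1` from the right) with top boundary the strict partition `κ` and bottom
boundary the strict partition `ν` (strict partitions are recorded as the finite sets of
their parts): the sum of the weights of all one-row states, i.e. of all admissible
assignments `h` of spins to the horizontal edges (with `h k.succ` the left edge and
`h k.castSucc` the right edge of column `k`) whose left and right boundary edges carry
`+` and whose vertical edges are occupied exactly at the parts of `κ` on top and of `ν`
on the bottom.  There is at most one such state. -/
def Zrow (m : ℕ) [NeZero m] (N : ℕ) (q Φ : ℂ) (α : ZMod m → ZMod m → ℂ) (z : ℂ)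
    (κ ν : Finset ℕ) : ℂ :=
  ∑ h : Fin (N + 1) → Spin m,
    if h (Fin.last N) = none ∧ h 0 = none ∧
        (∀ k : Fin N, Adm m (colC m k) (h k.succ)
          (if (k : ℕ) ∈ κ then some (colC m k) else none) (h k.castSucc)
          (if (k : ℕ) ∈ ν then some (colC m k) else none)) then
      ∏ k : Fin N,
        wt m q Φ α (colC m k) z (h k.succ)
          (if (k : ℕ) ∈ κ then some (colC m k) else none) (h k.castSucc)
          (if (k : ℕ) ∈ ν then some (colC m k) else none)
    else 0

/-- The transfer recursion for a one-dimensional chain with local weights `W` and right boundary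
state `r`: the partition function of the first `n` sites with left boundary state `a`. -/
def chainSum {S : Type*} [Fintype S] [DecidableEq S] (W : ℕ → S → S → ℂ) (r : S) : ℕ → S → ℂ
  | 0, a => if a = r then 1 else 0
  | n + 1, a => ∑ c, W n a c * chainSum W r n c

lemma sum_prod_eq_chainSum {S : Type*} [Fintype S] [DecidableEq S] (W : ℕ → S → S → ℂ) (r : S)
    (n : ℕ) (a : S) :
    (∑ h : Fin (n + 1) → S, if h (Fin.last n) = a ∧ h 0 = r then
      ∏ k : Fin n, W k (h k.succ) (h k.castSucc) else 0) = chainSum W r n a := by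
  induction n generalizing a with
  | zero =>
    rw [← (Equiv.funUnique (Fin 1) S).symm.sum_comp]
    simp only [chainSum, Equiv.funUnique_symm_apply, uniqueElim_const, Finset.univ_eq_empty,
      Finset.prod_empty, ite_and]
    simp
  | succ n ih =>
    rw [chainSum, ← (Fin.snocEquiv fun _ : Fin (n + 2) => S).sum_comp, Fintype.sum_prod_type]
    simp only [← ih, Finset.mul_sum]
    rw [Finset.sum_comm, Finset.sum_comm (s := (Finset.univ : Finset S))]
    refine Finset.sum_congr rfl fun h _ => ?_
    rw [Finset.sum_eq_single a, Finset.sum_eq_single (h (Fin.last n))]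
    · simp only [Fin.snocEquiv_apply, Fin.snoc_last, true_and, Fin.prod_univ_castSucc,
        Fin.succ_last, Fin.succ_castSucc, Fin.snoc_castSucc, Fin.val_castSucc, Fin.val_last]
      rw [show (0 : Fin (n + 2)) = Fin.castSucc 0 from rfl, Fin.snoc_castSucc]
      split_ifs <;> ring
    · intro c _ hc
      rw [if_neg fun h' => hc h'.1.symm, mul_zero]
    · simp
    · intro c _ hc
      simp [Fin.snocEquiv_apply, hc]
    · simp

lemma adm_of_wt_ne_zero {m : ℕ} {q Φ : ℂ} {α : ZMod m → ZMod m → ℂ} {j : ZMod m} {z : ℂ}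
    {a b c d : Spin m} (h : wt m q Φ α j z a b c d ≠ 0) : Adm m j a b c d := by
  rcases a with _ | a <;> rcases b with _ | b <;> rcases c with _ | c <;> rcases d with _ | d <;>
    simp_all [wt, Adm]

/-- The weight of the vertex in column `k` for given top and bottom boundaries, as a function of
its left and right spins. -/
def colWt (m : ℕ) (q Φ : ℂ) (α : ZMod m → ZMod m → ℂ) (z : ℂ) (κ ν : Finset ℕ) (k : ℕ)
    (a c : Spin m) : ℂ :=
  wt m q Φ α (colC m k) z a (if k ∈ κ then some (colC m k) else none) c
    (if k ∈ ν then some (colC m k) else none)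

lemma Zrow_eq_chainSum (m : ℕ) [NeZero m] (N : ℕ) (q Φ : ℂ) (α : ZMod m → ZMod m → ℂ) (z : ℂ)
    (κ ν : Finset ℕ) :
    Zrow m N q Φ α z κ ν = chainSum (colWt m q Φ α z κ ν) none N none := by
  rw [← sum_prod_eq_chainSum, Zrow]
  refine Finset.sum_congr rfl fun h _ => ?_
  by_cases hb : h (Fin.last N) = none ∧ h 0 = none
  · rw [if_pos hb]
    split_ifs with hadm
    · rfl
    · by_contra hne
      refine hadm ⟨hb.1, hb.2, fun k => adm_of_wt_ne_zero (q := q) (Φ := Φ) (α := α)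
        (z := z) fun h0 => hne ?_⟩
      exact (Finset.prod_eq_zero (Finset.mem_univ k) h0).symm
  · rw [if_neg hb, if_neg fun h' => hb ⟨h'.1, h'.2.1⟩]

/-- Columns occupied on both boundaries propagate the right boundary spin `+`. -/
lemma chainSum_of_occupied (m : ℕ) [NeZero m] (q Φ : ℂ) (α : ZMod m → ZMod m → ℂ) (z : ℂ)
    (κ ν : Finset ℕ) (n : ℕ) (hκ : ∀ k < n, k ∈ κ) (hν : ∀ k < n, k ∈ ν) (a : Spin m) :
    chainSum (colWt m q Φ α z κ ν) none n a = (-Φ / q) ^ n * if a = none then 1 else 0 := by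
  induction n generalizing a with
  | zero => simp [chainSum]
  | succ n ih =>
    rw [chainSum, Finset.sum_eq_single none]
    · rw [ih (fun k hk => hκ k (by omega)) (fun k hk => hν k (by omega))]
      cases a <;> simp [colWt, wt, hκ, hν, pow_succ']
    · intro c _ hc
      rw [ih (fun k hk => hκ k (by omega)) (fun k hk => hν k (by omega)), if_neg hc]
      simp
    · simp

/-- Columns empty on both boundaries propagate the left boundary spin `+`. -/
lemma chainSum_add_of_empty (m : ℕ) [NeZero m] (q Φ : ℂ) (α : ZMod m → ZMod m → ℂ) (z : ℂ)
    (κ ν : Finset ℕ) (M n : ℕ) (hκ : ∀ k ∈ κ, k < M) (hν : ∀ k ∈ ν, k < M) :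
    chainSum (colWt m q Φ α z κ ν) none (M + n) none =
      chainSum (colWt m q Φ α z κ ν) none M none := by
  induction n with
  | zero => rfl
  | succ n ih =>
    have h₁ : M + n ∉ κ := fun h => by have := hκ _ h; omega
    have h₂ : M + n ∉ ν := fun h => by have := hν _ h; omega
    rw [← Nat.add_assoc, chainSum, Finset.sum_eq_single none]
    · simp [colWt, wt, h₁, h₂, ih]
    · intro c _ hc
      cases c <;> simp_all [colWt, wt]
    · simp

lemma colWt_shift (m : ℕ) (q Φ : ℂ) (α : ZMod m → ZMod m → ℂ) (z : ℂ)
    (κ ν : Finset ℕ) (k : ℕ) :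
    colWt m q Φ α z (κ.image (· + m) ∪ Finset.range m) (ν.image (· + m) ∪ Finset.range m) (m + k) =
      colWt m q Φ α z κ ν k := by
  have hc : colC m (m + k) = colC m k := by simp [colC]
  have hmem (s : Finset ℕ) : m + k ∈ s.image (· + m) ∪ Finset.range m ↔ k ∈ s := by
    simp [Nat.add_comm m k]
  funext a c
  simp only [colWt, hc, hmem]

lemma chainSum_shift (m : ℕ) [NeZero m] (q Φ : ℂ) (α : ZMod m → ZMod m → ℂ) (z : ℂ)
    (κ ν : Finset ℕ) (n : ℕ) (a : Spin m) :
    chainSum (colWt m q Φ α z (κ.image (· + m) ∪ Finset.range m)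
        (ν.image (· + m) ∪ Finset.range m)) none (m + n) a =
      (-Φ / q) ^ m * chainSum (colWt m q Φ α z κ ν) none n a := by
  induction n generalizing a with
  | zero =>
    rw [Nat.add_zero, chainSum_of_occupied, chainSum]
    all_goals
      intro k hk
      simp [hk]
  | succ n ih =>
    rw [← Nat.add_assoc, chainSum, chainSum, Finset.mul_sum, colWt_shift]
    refine Finset.sum_congr rfl fun c _ => ?_
    rw [ih]
    ring

/-- shift identity for one-row weights: for strict partitions `λ, μ`
and `λ⁺ = (λ_1 + m, …, λ_ℓ + m, m − 1, …, 1, 0)`,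
`μ⁺ = (μ_1 + m, …, μ_{ℓ'} + m, m − 1, …, 1, 0)`, and every sufficiently wide grid,
`Z_{μ⁺,λ⁺}(z) = (−Φ/q)^m · Z_{μ,λ}(z)`. -/
theorem one_row_shift_identity
    (m : ℕ) [NeZero m] (q Φ : ℂ) (hq : q ≠ 0) (hΦ : Φ ≠ 0)
    (α : ZMod m → ZMod m → ℂ) (hα : ∀ x y, α x y * α y x = 1) (hα1 : ∀ x, α x x = 1)
    (lam mu : Finset ℕ) (N : ℕ) (hNm : m < N)
    (hN : ∀ x ∈ lam ∪ mu, x + m < N) (z : ℂ) (hz : z ≠ 0) :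
    Zrow m N q Φ α z (lam.image (· + m) ∪ Finset.range m)
        (mu.image (· + m) ∪ Finset.range m) =
      (-Φ / q) ^ m * Zrow m N q Φ α z lam mu := by
  obtain ⟨n, rfl⟩ := Nat.exists_eq_add_of_le hNm.le
  rw [Zrow_eq_chainSum, Zrow_eq_chainSum, chainSum_shift, Nat.add_comm m,
    chainSum_add_of_empty]
  · intro k hk
    have := hN k (Finset.mem_union_left _ hk)
    omega
  · intro k hk
    have := hN k (Finset.mem_union_right _ hk)
    omega
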